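/- Let X be a κ-color box-ball configuration with finite support. Then the length λ_1 of the longest soliton of X equals the maximum over all times s ≥ 0 of the number of nonzero entries of the infinite-capacity carrier Γ_s over X. -/

import Mathlib

/-- One step of the infinite-capacity carrier: the carrier is the multiset of the balls of
positive color it holds (it has infinitely many empty slots). An incoming ball `y ≥ 1`
replaces the largest ball of color strictly smaller than `y` if one exists (otherwise it
fills an empty slot); an incoming `0` ejects the ball of largest color (if any). -/
noncomputable def infStep (x : Multiset ℕ) (y : ℕ) : Multiset ℕ := by
  classical
  exact if y = 0 then x.erase x.sup
    else y ::ₘ x.erase ((x.filter fun a => a < y).sup)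

/-- The color of the ball exiting the infinite-capacity carrier (with `0` for an empty box). -/
noncomputable def infOut (x : Multiset ℕ) (y : ℕ) : ℕ := by
  classical
  exact if y = 0 then x.sup else (x.filter fun a => a < y).sup

/-- The infinite-capacity carrier process over the configuration `X`, started empty. -/
noncomputable def infCarrier (X : ℕ → ℕ) : ℕ → Multiset ℕ
  | 0 => 0
  | s + 1 => infStep (infCarrier X s) (X s)

/-- One step of the κ-color box-ball dynamics `X ↦ X'`, realized by running the
infinite-capacity carrier over `X` and recording the exiting ball colors. -/
noncomputable def bbsStep (X : ℕ → ℕ) : ℕ → ℕ := fun s => infOut (infCarrier X s) (X s)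

/-- `[a, a+n)` is a maximal nonincreasing run of balls (positive colors) in `Y`. -/
def IsMaxRun (Y : ℕ → ℕ) (a n : ℕ) : Prop :=
  1 ≤ n ∧ (∀ i, i < n → 0 < Y (a + i)) ∧
    (∀ i j, i ≤ j → j < n → Y (a + j) ≤ Y (a + i)) ∧
    (∀ b, b + 1 = a → (Y b = 0 ∨ Y b < Y a)) ∧
    (Y (a + n) = 0 ∨ Y (a + (n - 1)) < Y (a + n))

/-- `rowLen k Y` is the number of maximal nonincreasing runs of length at least `k` in `Y`;
for a fully decomposed configuration this is the `k`-th row length `ρ_k` of the soliton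
Young diagram (the number of solitons of length `≥ k`). -/
noncomputable def rowLen (k : ℕ) (Y : ℕ → ℕ) : ℕ :=
  Set.ncard {a | ∃ n, k ≤ n ∧ IsMaxRun Y a n}

/-- `colLen j Y` is the `j`-th column length `λ_j` of the associated Young diagram
(the conjugate of the row lengths); for a fully decomposed configuration this is the `j`-th
longest soliton length. -/
noncomputable def colLen (j : ℕ) (Y : ℕ → ℕ) : ℕ :=
  Set.ncard {i | 1 ≤ i ∧ j ≤ rowLen i Y}

/-- The four possible moves of the infinite-capacity carrier. -/
lemma infStep_cases (x : Multiset ℕ) (y : ℕ) (h0 : 0 ∉ x) :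
    (y = 0 ∧ x = 0 ∧ infOut x y = 0 ∧ infStep x y = 0) ∨
    (∃ w, y = 0 ∧ 0 < infOut x y ∧ x = infOut x y ::ₘ w ∧ infStep x y = w ∧
      ∀ a ∈ w, a ≤ infOut x y) ∨
    (0 < y ∧ infOut x y = 0 ∧ infStep x y = y ::ₘ x ∧ ∀ a ∈ x, y ≤ a) ∨
    (∃ w, 0 < y ∧ 0 < infOut x y ∧ infOut x y < y ∧ x = infOut x y ::ₘ w ∧
      infStep x y = y ::ₘ w ∧ ∀ a ∈ w, a < y → a ≤ infOut x y) := by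
  classical
  have sup_mem : ∀ m : Multiset ℕ, m ≠ 0 → m.sup ∈ m := by
    intro m
    induction m using Multiset.induction with
    | empty => simp
    | cons a m ih =>
      intro _
      by_cases hm : m = 0
      · simp [hm]
      · rw [Multiset.sup_cons]
        rcases le_total a m.sup with h | h
        · rw [sup_eq_right.2 h]; exact Multiset.mem_cons_of_mem (ih hm)
        · rw [sup_eq_left.2 h]; exact Multiset.mem_cons_self _ _
  rcases Nat.eq_zero_or_pos y with rfl | hy
  · by_cases hx : x = 0
    · left; subst hx; simp [infOut, infStep]
    · right; left
      have hm := sup_mem x hx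
      refine ⟨x.erase x.sup, rfl, ?_, ?_, ?_, ?_⟩
      · simp only [infOut, if_true]
        exact Nat.pos_of_ne_zero fun h => h0 (h ▸ hm)
      · simp [infOut, Multiset.cons_erase hm]
      · simp [infStep]
      · intro a ha
        simpa [infOut] using Multiset.le_sup (Multiset.mem_of_mem_erase ha)
  · right; right
    by_cases hx : x.filter (fun a => a < y) = 0
    · left
      refine ⟨hy, ?_, ?_, ?_⟩
      · simp [infOut, hy.ne', hx]
      · simp [infStep, hy.ne', hx, Multiset.erase_of_notMem h0]
      · intro a ha
        by_contra! h
        have : a ∈ x.filter (fun a => a < y) := Multiset.mem_filter.2 ⟨ha, h⟩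
        simp [hx] at this
    · right
      have hm := Multiset.mem_filter.1 (sup_mem _ hx)
      refine ⟨x.erase ((x.filter fun a => a < y).sup), hy, ?_, ?_, ?_, ?_, ?_⟩
      · simp only [infOut, hy.ne', if_false]
        exact Nat.pos_of_ne_zero fun h => h0 (h ▸ hm.1)
      · simpa only [infOut, hy.ne', if_false] using hm.2
      · simp only [infOut, hy.ne', if_false]
        exact (Multiset.cons_erase hm.1).symm
      · simp [infStep, hy.ne']
      · intro a ha hay
        simp only [infOut, hy.ne', if_false]
        exact Multiset.le_sup (Multiset.mem_filter.2 ⟨Multiset.mem_of_mem_erase ha, hay⟩)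

lemma zero_notMem_infCarrier (X : ℕ → ℕ) (s : ℕ) : 0 ∉ infCarrier X s := by
  induction s with
  | zero => simp [infCarrier]
  | succ s ih =>
    rw [infCarrier]
    rcases infStep_cases _ (X s) ih with h | ⟨w, h1, h2, h3, h4, h5⟩ | ⟨h1, h2, h3, h4⟩ |
      ⟨w, h1, h2, h3, h4, h5, h6⟩
    · rw [h.2.2.2]; simp
    · rw [h4]; rw [h3] at ih
      exact fun h => ih (Multiset.mem_cons_of_mem h)
    · rw [h3, Multiset.mem_cons]
      rintro (h | h)
      · omega
      · exact ih h
    · rw [h5, Multiset.mem_cons]; rw [h4] at ih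
      rintro (h | h)
      · omega
      · exact ih (Multiset.mem_cons_of_mem h)

/-- The number of balls of color at least `c`. -/
def countGE (c : ℕ) (x : Multiset ℕ) : ℕ := x.countP fun a => c ≤ a

/-- The number of balls of color at most `c`. -/
def countLE (c : ℕ) (x : Multiset ℕ) : ℕ := x.countP fun a => a ≤ c

lemma countGE_cons (c a : ℕ) (x : Multiset ℕ) :
    countGE c (a ::ₘ x) = countGE c x + if c ≤ a then 1 else 0 :=
  Multiset.countP_cons _ _ _

lemma countLE_cons (c a : ℕ) (x : Multiset ℕ) :
    countLE c (a ::ₘ x) = countLE c x + if a ≤ c then 1 else 0 :=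
  Multiset.countP_cons _ _ _

lemma countGE_le_card (c : ℕ) (x : Multiset ℕ) : countGE c x ≤ x.card :=
  Multiset.countP_le_card _ _

lemma countLE_le_card (c : ℕ) (x : Multiset ℕ) : countLE c x ≤ x.card :=
  Multiset.countP_le_card _ _

lemma countGE_zero_left (x : Multiset ℕ) : countGE 0 x = x.card := by
  simp [countGE]

lemma countLE_sup (x : Multiset ℕ) : countLE x.sup x = x.card :=
  Multiset.countP_eq_card.2 fun _ ha => Multiset.le_sup ha

lemma countGE_mono {c d : ℕ} (x : Multiset ℕ) (h : ∀ a ∈ x, d ≤ a → c ≤ a) :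
    countGE d x ≤ countGE c x := by
  induction x using Multiset.induction with
  | empty => simp [countGE]
  | cons b x ih =>
    have h1 := ih fun a ha => h a (Multiset.mem_cons_of_mem ha)
    have h2 := h b (Multiset.mem_cons_self _ _)
    rw [countGE_cons, countGE_cons]
    split_ifs <;> omega

lemma countLE_mono {c d : ℕ} (x : Multiset ℕ) (h : ∀ a ∈ x, a ≤ d → a ≤ c) :
    countLE d x ≤ countLE c x := by
  induction x using Multiset.induction with
  | empty => simp [countLE]
  | cons b x ih =>
    have h1 := ih fun a ha => h a (Multiset.mem_cons_of_mem ha)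
    have h2 := h b (Multiset.mem_cons_self _ _)
    rw [countLE_cons, countLE_cons]
    split_ifs <;> omega

lemma countGE_eq_zero {c : ℕ} {x : Multiset ℕ} (h : ∀ a ∈ x, a < c) : countGE c x = 0 :=
  Multiset.countP_eq_zero.2 fun a ha => not_le.2 (h a ha)

lemma countLE_eq_zero {c : ℕ} {x : Multiset ℕ} (h : ∀ a ∈ x, c < a) : countLE c x = 0 :=
  Multiset.countP_eq_zero.2 fun a ha => not_le.2 (h a ha)

/-- An incoming empty box decreases each positive upper count by one. -/
lemma countGE_infStep_zero {x : Multiset ℕ} (h0 : 0 ∉ x) (c : ℕ) :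
    countGE c (infStep x 0) = countGE c x - 1 := by
  rcases infStep_cases x 0 h0 with ⟨-, h2, -, h4⟩ | ⟨w, -, h2, h3, h4, h5⟩ | ⟨h1, -⟩ | ⟨w, h1, -⟩
  · rw [h4, h2]; simp [countGE]
  · rw [h4]
    conv_rhs => rw [h3]
    rw [countGE_cons]
    split_ifs with h
    · omega
    · rw [countGE_eq_zero fun a ha => (h5 a ha).trans_lt (not_le.1 h)]
  · omega
  · omega

/-- The max-plus recursion for the upper counts of the carrier. -/
lemma countGE_infStep_pos {x : Multiset ℕ} {y : ℕ} (h0 : 0 ∉ x) (hy : 0 < y) (c : ℕ) :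
    countGE c (infStep x y) =
      if c ≤ y then max (countGE c x) (countGE y x + 1) else countGE c x := by
  rcases infStep_cases x y h0 with ⟨h1, -⟩ | ⟨w, h1, -⟩ | ⟨h1, h2, h3, h4⟩ |
      ⟨w, h1, h2, h3, h4, h5, h6⟩
  · omega
  · omega
  · rw [h3, countGE_cons]
    split_ifs with h
    · have := countGE_mono x (c := c) (d := y) fun a _ h' => h.trans h'
      have := countGE_mono x (c := y) (d := c) fun a ha _ => h4 a ha
      omega
    · rfl
  · rw [h5]
    conv_rhs => rw [h4]
    simp only [countGE_cons]
    by_cases h : c ≤ y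
    · have h7 := countGE_mono w (c := c) (d := y) fun a _ h' => h.trans h'
      by_cases hz : c ≤ infOut x y
      · simp [h, hz, not_le.2 h3]; omega
      · have h8 := countGE_mono w (c := y) (d := c) fun a ha hc => by
          by_contra! hlt
          exact hz (hc.trans (h6 a ha hlt))
        simp [h, hz, not_le.2 h3]; omega
    · have : ¬ c ≤ infOut x y := by omega
      simp [h, this]

/-- When an empty box exits, the lower counts satisfy the recursion of the reversed carrier. -/
lemma countLE_infStep_zero {x : Multiset ℕ} {y : ℕ} (h0 : 0 ∉ x) (hz : infOut x y = 0) (c : ℕ) :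
    countLE c x = countLE c (infStep x y) - 1 := by
  rcases infStep_cases x y h0 with ⟨-, h2, -, h4⟩ | ⟨w, -, h2, -⟩ | ⟨h1, h2, h3, h4⟩ |
      ⟨w, h1, h2, -⟩
  · rw [h4, h2]; simp [countLE]
  · omega
  · rw [h3, countLE_cons]
    split_ifs with h
    · omega
    · rw [countLE_eq_zero fun a ha => (not_le.1 h).trans_le (h4 a ha)]
  · omega

/-- When a ball exits, the lower counts satisfy the recursion of the reversed carrier. -/
lemma countLE_infStep_pos {x : Multiset ℕ} {y : ℕ} (h0 : 0 ∉ x) (hz : 0 < infOut x y) (c : ℕ) :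
    countLE c x =
      if infOut x y ≤ c then max (countLE c (infStep x y)) (countLE (infOut x y) (infStep x y) + 1)
      else countLE c (infStep x y) := by
  rcases infStep_cases x y h0 with ⟨-, -, h1, -⟩ | ⟨w, h1, h2, h3, h4, h5⟩ | ⟨-, h1, -⟩ |
      ⟨w, h1, h2, h3, h4, h5, h6⟩
  · omega
  · rw [h4]
    conv_lhs => rw [h3]
    rw [countLE_cons]
    split_ifs with h
    · have := countLE_mono w (c := c) (d := infOut x y) fun a _ h' => h'.trans h
      have := countLE_mono w (c := infOut x y) (d := c) fun a ha _ => h5 a ha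
      omega
    · rfl
  · omega
  · rw [h5]
    conv_lhs => rw [h4]
    simp only [countLE_cons]
    by_cases h : infOut x y ≤ c
    · have h7 := countLE_mono w (c := c) (d := infOut x y) fun a _ h' => h'.trans h
      by_cases hc : y ≤ c
      · simp [h, hc, not_le.2 h3]; omega
      · have h8 := countLE_mono w (c := infOut x y) (d := c) fun a ha hac =>
          h6 a ha (hac.trans_lt (not_le.1 hc))
        simp [h, hc, not_le.2 h3]; omega
    · have : ¬ y ≤ c := by omega
      simp [h, this]

lemma countGE_infCarrier_succ_of_zero {X : ℕ → ℕ} {s : ℕ} (h : X s = 0) (c : ℕ) :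
    countGE c (infCarrier X (s + 1)) = countGE c (infCarrier X s) - 1 := by
  rw [infCarrier, h, countGE_infStep_zero (zero_notMem_infCarrier X s)]

lemma card_infCarrier_add {X : ℕ → ℕ} {R : ℕ} (h : ∀ s, R ≤ s → X s = 0) (k : ℕ) :
    (infCarrier X (R + k)).card = (infCarrier X R).card - k := by
  induction k with
  | zero => simp
  | succ k ih =>
    have := countGE_infCarrier_succ_of_zero (h (R + k) (by omega)) 0
    simp only [countGE_zero_left] at this
    rw [← add_assoc, this, ih]; omega

/-- Part of the carrier over `X` at position `s`, together with the carrier over the updated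
configuration, is carried by the latter further to the right. -/
lemma exists_card_infCarrier_bbsStep_ge {X : ℕ → ℕ} {T : ℕ}
    (hT : ∀ s, T ≤ s → infCarrier X s = 0) (k : ℕ) :
    ∀ s c, T ≤ s + k → ∃ s', s + countLE c (infCarrier X s) ≤ s' ∧
      countGE c (infCarrier (bbsStep X) s) + countLE c (infCarrier X s) ≤
        (infCarrier (bbsStep X) s').card := by
  induction k with
  | zero =>
    intro s c hs
    refine ⟨s, ?_, ?_⟩ <;> rw [hT s (by omega)]
    · simp [countLE]
    · simpa [countLE] using countGE_le_card c _
  | succ k ih =>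
    intro s c hs
    have hX := zero_notMem_infCarrier X s
    have hD := zero_notMem_infCarrier (bbsStep X) s
    have key := fun d => ih (s + 1) d (by omega)
    simp only [infCarrier] at key
    obtain ⟨s₁, h1, h2⟩ := key c
    rcases Nat.eq_zero_or_pos (infOut (infCarrier X s) (X s)) with hz | hz
    · have e1 := countLE_infStep_zero hX hz c
      have e2 := countGE_infStep_zero hD c
      rw [show bbsStep X s = 0 from hz] at h2
      by_cases h : countLE c (infCarrier X s) = 0
      · refine ⟨s, by omega, ?_⟩
        rw [h]; exact countGE_le_card c _
      · exact ⟨s₁, by omega, by omega⟩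
    · have e1 := countLE_infStep_pos hX hz c
      obtain ⟨s₂, h3, h4⟩ := key (infOut (infCarrier X s) (X s))
      have hz' : 0 < bbsStep X s := hz
      have e2 := countGE_infStep_pos hD hz' c
      have e3 := countGE_infStep_pos hD hz' (bbsStep X s)
      rw [if_pos le_rfl] at e3
      change s + 1 + countLE (bbsStep X s) _ ≤ s₂ at h3
      change countGE (bbsStep X s) _ + countLE (bbsStep X s) _ ≤ _ at h4
      change countLE c (infCarrier X s) = if bbsStep X s ≤ c then
        max _ (countLE (bbsStep X s) _ + 1) else _ at e1
      have e2' : countGE c (infCarrier (bbsStep X) s) ≤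
          countGE c (infStep (infCarrier (bbsStep X) s) (bbsStep X s)) := by
        rw [e2]; split_ifs <;> omega
      by_cases hc : bbsStep X s ≤ c
      · rw [if_pos hc] at e1
        rcases max_choice (countLE c (infStep (infCarrier X s) (X s)))
          (countLE (bbsStep X s) (infStep (infCarrier X s) (X s)) + 1) with e | e
        · exact ⟨s₁, by omega, by omega⟩
        · have := countGE_mono (infCarrier (bbsStep X) s) (c := bbsStep X s) (d := c)
            fun a _ h => hc.trans h
          exact ⟨s₂, by omega, by omega⟩
      · rw [if_neg hc] at e1
        exact ⟨s₁, by omega, by omega⟩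

/-- The carrier over the updated configuration is never larger than all carriers over the
original configuration. -/
lemma exists_card_infCarrier_ge (X : ℕ → ℕ) (s : ℕ) :
    ∀ c, ∃ s', countGE c (infCarrier (bbsStep X) s) + countLE c (infCarrier X s) ≤
        (infCarrier X s').card := by
  induction s with
  | zero => exact fun c => ⟨0, by simp [infCarrier, countGE, countLE]⟩
  | succ s ih =>
    intro c
    have hX := zero_notMem_infCarrier X s
    have hD := zero_notMem_infCarrier (bbsStep X) s
    obtain ⟨s₁, h1⟩ := ih c
    have hle := countLE_le_card c (infCarrier X (s + 1))
    rw [infCarrier] at hle ⊢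
    rcases Nat.eq_zero_or_pos (bbsStep X s) with hz | hz
    · have e1 := countLE_infStep_zero hX hz c
      have e2 := countGE_infStep_zero hD c
      rw [← hz] at e2
      by_cases h : countGE c (infStep (infCarrier (bbsStep X) s) (bbsStep X s)) = 0
      · exact ⟨s + 1, by rw [h, zero_add]; exact hle⟩
      · exact ⟨s₁, by rw [infCarrier]; omega⟩
    · have e1 := countLE_infStep_pos hX hz c
      have e2 := countGE_infStep_pos hD hz c
      have e3 := countLE_infStep_pos hX hz (bbsStep X s)
      change countLE c (infCarrier X s) = if bbsStep X s ≤ c then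
        max _ (countLE (bbsStep X s) _ + 1) else _ at e1
      change countLE (bbsStep X s) (infCarrier X s) = if bbsStep X s ≤ bbsStep X s then
        max _ (countLE (bbsStep X s) _ + 1) else _ at e3
      rw [if_pos le_rfl] at e3
      have e1' : countLE c (infStep (infCarrier X s) (X s)) ≤ countLE c (infCarrier X s) := by
        rw [e1]; split_ifs <;> omega
      rw [infCarrier]
      by_cases hc : c ≤ bbsStep X s
      · rw [if_pos hc] at e2
        rcases max_choice (countGE c (infCarrier (bbsStep X) s))
          (countGE (bbsStep X s) (infCarrier (bbsStep X) s) + 1) with e | e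
        · exact ⟨s₁, by omega⟩
        · obtain ⟨s₂, h2⟩ := ih (bbsStep X s)
          have := countLE_mono (infStep (infCarrier X s) (X s)) (c := bbsStep X s) (d := c)
            fun a _ h => h.trans hc
          exact ⟨s₂, by omega⟩
      · rw [if_neg hc] at e2
        exact ⟨s₁, by omega⟩

/-- A nonincreasing run of balls is held entirely by the carrier just after it. -/
lemma le_countGE_infCarrier_of_run {Y : ℕ → ℕ} {a n : ℕ} (hpos : ∀ i, i < n → 0 < Y (a + i))
    (hmono : ∀ i j, i ≤ j → j < n → Y (a + j) ≤ Y (a + i)) :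
    ∀ c, (∀ i, i < n → c ≤ Y (a + i)) → n ≤ countGE c (infCarrier Y (a + n)) := by
  induction n with
  | zero => simp
  | succ n ih =>
    intro c hc
    have h := ih (fun i hi => hpos i (by omega)) (fun i j hij hj => hmono i j hij (by omega))
      (Y (a + n)) fun i hi => hmono i n hi.le (by omega)
    rw [← add_assoc, infCarrier, countGE_infStep_pos (zero_notMem_infCarrier Y _)
      (hpos n (by omega)), if_pos (hc n (by omega))]
    omega

lemma le_card_infCarrier_of_run {Y : ℕ → ℕ} {a n : ℕ} (hpos : ∀ i, i < n → 0 < Y (a + i))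
    (hmono : ∀ i j, i ≤ j → j < n → Y (a + j) ≤ Y (a + i)) :
    n ≤ (infCarrier Y (a + n)).card := by
  simpa [countGE_zero_left] using
    le_countGE_infCarrier_of_run hpos hmono 0 fun _ _ => Nat.zero_le _

/-- Past the last ball, the carrier deposits its content. -/
lemma bbsStep_add {X : ℕ → ℕ} {R : ℕ} (h : ∀ s, R ≤ s → X s = 0) (k : ℕ) :
    bbsStep X (R + k) = (infCarrier X (R + k)).sup := by
  simp [bbsStep, infOut, h (R + k) (by omega)]

lemma bbsStep_eq_zero {X : ℕ → ℕ} {R : ℕ} (h : ∀ s, R ≤ s → X s = 0) {s : ℕ}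
    (hs : R + (infCarrier X R).card ≤ s) : bbsStep X s = 0 := by
  obtain ⟨k, rfl⟩ := Nat.exists_eq_add_of_le (show R ≤ s by omega)
  have : infCarrier X (R + k) = 0 := by
    rw [← Multiset.card_eq_zero, card_infCarrier_add h]; omega
  rw [bbsStep_add h, this]; rfl

lemma bbsStep_pos {X : ℕ → ℕ} {R : ℕ} (h : ∀ s, R ≤ s → X s = 0) {k : ℕ}
    (hk : k < (infCarrier X R).card) : 0 < bbsStep X (R + k) := by
  rw [bbsStep_add h]
  have hc := card_infCarrier_add h k
  obtain ⟨a, ha⟩ := Multiset.card_pos_iff_exists_mem.1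
    (show 0 < (infCarrier X (R + k)).card by omega)
  refine (Nat.pos_of_ne_zero ?_).trans_le (Multiset.le_sup ha)
  rintro rfl
  exact zero_notMem_infCarrier _ _ ha

lemma bbsStep_antitone {X : ℕ → ℕ} {R : ℕ} (h : ∀ s, R ≤ s → X s = 0) :
    Antitone fun k => bbsStep X (R + k) := by
  classical
  refine antitone_nat_of_succ_le fun k => ?_
  rw [bbsStep_add h, bbsStep_add h, ← add_assoc, infCarrier, h (R + k) (by omega)]
  refine Multiset.sup_mono ?_
  simp only [infStep, if_true]
  exact Multiset.erase_subset _ _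

/-- A bound for the support of the configuration at time `t`, given a bound `R` at time `0`. -/
noncomputable def frontBound (X : ℕ → ℕ) (R : ℕ) : ℕ → ℕ
  | 0 => R
  | t + 1 => frontBound X R t + (infCarrier (bbsStep^[t] X) (frontBound X R t)).card

/-- The length of the run deposited beyond the front at time `t`. -/
noncomputable def frontLen (X : ℕ → ℕ) (R t : ℕ) : ℕ :=
  (infCarrier (bbsStep^[t] X) (frontBound X R t)).card

lemma frontBound_succ (X : ℕ → ℕ) (R t : ℕ) :
    frontBound X R (t + 1) = frontBound X R t + frontLen X R t := rfl

lemma iterate_bbsStep_eq_zero {X : ℕ → ℕ} {R : ℕ} (h : ∀ s, R ≤ s → X s = 0) (t : ℕ) :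
    ∀ s, frontBound X R t ≤ s → bbsStep^[t] X s = 0 := by
  induction t with
  | zero => exact h
  | succ t ih =>
    intro s hs
    rw [Function.iterate_succ_apply']
    exact bbsStep_eq_zero ih hs

lemma front_run {X : ℕ → ℕ} {R : ℕ} (h : ∀ s, R ≤ s → X s = 0) (t : ℕ) :
    (∀ i, i < frontLen X R t → 0 < bbsStep^[t + 1] X (frontBound X R t + i)) ∧
    (∀ i j, i ≤ j → j < frontLen X R t →
      bbsStep^[t + 1] X (frontBound X R t + j) ≤ bbsStep^[t + 1] X (frontBound X R t + i)) := by
  rw [Function.iterate_succ_apply']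
  have ht := iterate_bbsStep_eq_zero h t
  exact ⟨fun i hi => bbsStep_pos ht hi, fun i j hij _ => bbsStep_antitone ht hij⟩

lemma frontLen_monotone {X : ℕ → ℕ} {R : ℕ} (h : ∀ s, R ≤ s → X s = 0) :
    Monotone (frontLen X R) :=
  monotone_nat_of_le_succ fun t => le_card_infCarrier_of_run (front_run h t).1 (front_run h t).2

lemma card_infCarrier_iterate_le {X : ℕ → ℕ} {M : ℕ} (hM : ∀ s, (infCarrier X s).card ≤ M)
    (t s : ℕ) : (infCarrier (bbsStep^[t] X) s).card ≤ M := by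
  induction t generalizing s with
  | zero => exact hM s
  | succ t ih =>
    rw [Function.iterate_succ_apply']
    obtain ⟨u, hu⟩ := exists_card_infCarrier_ge (bbsStep^[t] X) s 0
    rw [countGE_zero_left] at hu
    exact ((Nat.le_add_right _ _).trans hu).trans (ih u)

/-- A carrier load `M` is transported with speed at least `M`. -/
lemma exists_card_infCarrier_iterate_ge {X : ℕ → ℕ} {R M : ℕ} (h : ∀ s, R ≤ s → X s = 0)
    (hM : ∃ s, M ≤ (infCarrier X s).card) (t : ℕ) :
    ∃ s, t * M ≤ s ∧ M ≤ (infCarrier (bbsStep^[t] X) s).card := by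
  induction t with
  | zero => simpa using hM
  | succ t ih =>
    obtain ⟨s, hs, hc⟩ := ih
    have ht := iterate_bbsStep_eq_zero h t
    rw [Function.iterate_succ_apply']
    obtain ⟨s', h1, h2⟩ := exists_card_infCarrier_bbsStep_ge (X := bbsStep^[t] X)
      (T := frontBound X R (t + 1)) (fun s hs => by
        obtain ⟨k, rfl⟩ := Nat.exists_eq_add_of_le
          (show frontBound X R t ≤ s by rw [frontBound_succ] at hs; omega)
        rw [← Multiset.card_eq_zero, card_infCarrier_add ht]
        rw [frontBound_succ, frontLen] at hs
        omega)
      (frontBound X R (t + 1)) s (infCarrier (bbsStep^[t] X) s).sup (by omega)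
    rw [countLE_sup] at h1 h2
    exact ⟨s', by rw [add_mul]; omega, by omega⟩

lemma le_frontLen {X : ℕ → ℕ} {R M : ℕ} (h : ∀ s, R ≤ s → X s = 0)
    (hM : ∃ s, M ≤ (infCarrier X s).card) {t : ℕ} (ht : R < t) : M ≤ frontLen X R t := by
  by_contra! hlt
  have hb : ∀ u, u ≤ t → frontBound X R u + u ≤ R + u * M := by
    intro u
    induction u with
    | zero => simp [frontBound]
    | succ u ih =>
      intro hu
      have h1 := ih (by omega)
      have h2 := frontLen_monotone h (show u ≤ t by omega)
      rw [frontBound_succ, add_mul]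
      omega
  obtain ⟨s, hs, hc⟩ := exists_card_infCarrier_iterate_ge h hM t
  have h3 := hb t le_rfl
  obtain ⟨k, rfl⟩ := Nat.exists_eq_add_of_le (show frontBound X R t ≤ s by omega)
  rw [card_infCarrier_add (iterate_bbsStep_eq_zero h t)] at hc
  rw [frontLen] at hlt
  omega

/-- A nonincreasing run of balls followed by an empty box extends to a maximal one. -/
lemma exists_isMaxRun {Y : ℕ → ℕ} {a n : ℕ} (hn : 1 ≤ n) (hpos : ∀ i, i < n → 0 < Y (a + i))
    (hmono : ∀ i j, i ≤ j → j < n → Y (a + j) ≤ Y (a + i)) (hend : Y (a + n) = 0) :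
    ∃ b m, n ≤ m ∧ IsMaxRun Y b m := by
  induction a generalizing n with
  | zero => exact ⟨0, n, le_rfl, hn, hpos, hmono, fun b hb => by omega, Or.inl hend⟩
  | succ a ih =>
    by_cases hY : Y a = 0 ∨ Y a < Y (a + 1)
    · refine ⟨a + 1, n, le_rfl, hn, hpos, hmono, fun b hb => ?_, Or.inl hend⟩
      obtain rfl : b = a := by omega
      exact hY
    · push Not at hY
      obtain ⟨b, m, hm, hr⟩ := ih (n := n + 1) (by omega)
        (fun i hi => by
          rcases i with _ | i
          · exact Nat.pos_of_ne_zero hY.1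
          · have := hpos i (by omega)
            rwa [add_right_comm] at this)
        (fun i j hij hj => by
          rcases i with _ | i <;> rcases j with _ | j
          · exact le_rfl
          · have := hmono 0 j (by omega) (by omega)
            rw [add_right_comm] at this
            exact this.trans hY.2
          · omega
          · have := hmono i j (by omega) (by omega)
            rwa [add_right_comm a 1 j, add_right_comm a 1 i] at this)
        (by rwa [add_right_comm] at hend)
      exact ⟨b, m, by omega, hr⟩

/-- The first column length is the maximal length of a run. -/
lemma colLen_one_eq {Y : ℕ → ℕ} {B M : ℕ} (hB : ∀ s, B ≤ s → Y s = 0)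
    (hle : ∀ a n, IsMaxRun Y a n → n ≤ M) (hge : 1 ≤ M → ∃ a n, M ≤ n ∧ IsMaxRun Y a n) :
    colLen 1 Y = M := by
  have hset : {i | 1 ≤ i ∧ 1 ≤ rowLen i Y} = Set.Icc 1 M := by
    ext i
    have hfin : {a | ∃ n, i ≤ n ∧ IsMaxRun Y a n}.Finite := by
      refine (Set.finite_Iio B).subset ?_
      rintro a ⟨n, -, hn, hpos, -⟩
      by_contra! h
      exact (hpos 0 hn).ne' (hB a (not_lt.1 h))
    simp only [Set.mem_ofPred_eq, Set.mem_Icc, rowLen, Nat.one_le_iff_ne_zero (n := Set.ncard _),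
      ← Nat.pos_iff_ne_zero (n := Set.ncard _), Set.ncard_pos hfin]
    refine and_congr_right fun hi => ⟨?_, fun hiM => ?_⟩
    · rintro ⟨a, n, hin, hr⟩
      exact hin.trans (hle a n hr)
    · obtain ⟨a, n, hn, hr⟩ := hge (hi.trans hiM)
      exact ⟨a, n, hiM.trans hn, hr⟩
  rw [colLen, hset, Set.ncard_eq_toFinset_card']
  simp

/-- For a κ-color box-ball configuration `X` with finite support, the
longest soliton length `λ_1` of `X` (the eventual longest-run length of the trajectory,
once the system has decomposed into solitons) equals the maximum over all times `s` of the
number of nonzero entries of the infinite-capacity carrier `Γ_s` over `X`. -/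
theorem stmt4 (κ : ℕ) (X : ℕ → ℕ) (hfin : (Function.support X).Finite)
    (hcol : ∀ s, X s ≤ κ) :
    ∃ t₀ : ℕ, ∀ t ≥ t₀,
      colLen 1 (bbsStep^[t] X) = sSup {m | ∃ s, (infCarrier X s).card = m} := by
  obtain ⟨R, hR⟩ : ∃ R, ∀ s, R ≤ s → X s = 0 := by
    obtain ⟨R, hR⟩ := hfin.bddAbove
    refine ⟨R + 1, fun s hs => ?_⟩
    by_contra h
    have := hR (Function.mem_support.2 h)
    omega
  have hbdd : BddAbove {m | ∃ s, (infCarrier X s).card = m} := by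
    obtain ⟨C, hC⟩ := ((Set.finite_Iic R).image fun s => (infCarrier X s).card).bddAbove
    refine ⟨C, ?_⟩
    rintro _ ⟨s, rfl⟩
    rcases le_total s R with h | h
    · exact hC ⟨s, h, rfl⟩
    · obtain ⟨k, rfl⟩ := Nat.exists_eq_add_of_le h
      rw [card_infCarrier_add hR]
      exact (Nat.sub_le _ _).trans (hC ⟨R, Set.mem_Iic.2 le_rfl, rfl⟩)
  obtain ⟨s₀, hs₀⟩ : ∃ s, (infCarrier X s).card = sSup {m | ∃ s, (infCarrier X s).card = m} :=
    Nat.sSup_mem (s := {m | ∃ s, (infCarrier X s).card = m}) ⟨_, 0, rfl⟩ hbdd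
  have hM : ∀ s, (infCarrier X s).card ≤ sSup {m | ∃ s, (infCarrier X s).card = m} :=
    fun s => le_csSup hbdd ⟨s, rfl⟩
  refine ⟨R + 2, fun t ht => ?_⟩
  obtain ⟨u, rfl⟩ : ∃ u, t = u + 1 := ⟨t - 1, by omega⟩
  have hlen := le_frontLen hR ⟨s₀, hs₀.ge⟩ (show R < u by omega)
  refine colLen_one_eq (iterate_bbsStep_eq_zero hR (u + 1)) ?_ fun h1 => ?_
  · rintro a n ⟨-, hpos, hmono, -⟩
    exact (le_card_infCarrier_of_run hpos hmono).trans (card_infCarrier_iterate_le hM _ _)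
  · obtain ⟨a, n, hn, hr⟩ := exists_isMaxRun (h1.trans hlen) (front_run hR u).1 (front_run hR u).2
      (iterate_bbsStep_eq_zero hR (u + 1) _ (frontBound_succ X R u).ge)
    exact ⟨a, n, hlen.trans hn, hr⟩
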